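/- arXiv:1208.2185 — 2 statements merged into one kernel-verified Lean document; each statement's English description precedes it below -/
import Mathlib

section
/- For every integer n >= 4, the two polynomials [t1,t2][t1,t2,t1^(n-3)] and [t1,t2][t3,t1^(n-2)] - [t1,t3][t2,t1^(n-2)] belong to the T-ideal generated by [t1,t2][t3,t1^(n-3)] - [t1,t3][t2,t1^(n-3)] together with the three polynomials [[t1,t2][t3,t4],t5], [t1,t2][t3,t4][t5,t6], and s4(t1,t2,t3,t4). -/
noncomputable section

/-- The commutator `[a,b] = a*b - b*a`. -/
def br {A : Type*} [Ring A] (a b : A) : A := a * b - b * a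

/-- `adIter c l z` is the left-normed commutator `[z, c^{(l)}] = [z, c, ..., c]`
with `l` occurrences of `c`. -/
def adIter {A : Type*} [Ring A] (c : A) (l : ℕ) (z : A) : A :=
  (fun w => w * c - c * w)^[l] z

/-- The free generators of the free unital associative algebra `K⟨t1, t2, ...⟩`;
`tv K i` corresponds to `t_{i+1}`. -/
def tv (K : Type*) [Field K] (i : ℕ) : FreeAlgebra K ℕ := FreeAlgebra.ι K i

/-- The standard polynomial `s4(t1,t2,t3,t4)`. -/
def s4poly (K : Type*) [Field K] : FreeAlgebra K ℕ :=
  ∑ σ : Equiv.Perm (Fin 4), (Equiv.Perm.sign σ : ℤ) •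
    (tv K (σ 0) * tv K (σ 1) * tv K (σ 2) * tv K (σ 3))

/-- The polynomial `[[t1,t2][t3,t4],t5]`. -/
def p₁ (K : Type*) [Field K] : FreeAlgebra K ℕ :=
  br (br (tv K 0) (tv K 1) * br (tv K 2) (tv K 3)) (tv K 4)

/-- The polynomial `[t1,t2][t3,t4][t5,t6]`. -/
def p₂ (K : Type*) [Field K] : FreeAlgebra K ℕ :=
  br (tv K 0) (tv K 1) * br (tv K 2) (tv K 3) * br (tv K 4) (tv K 5)

/-- The T-ideal of `K⟨t1, t2, ...⟩` generated by a set `S`: the two-sided ideal generated by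
all images of elements of `S` under unital `K`-algebra endomorphisms of the free algebra. -/
def TIdealGen (K : Type*) [Field K] (S : Set (FreeAlgebra K ℕ)) :
    TwoSidedIdeal (FreeAlgebra K ℕ) :=
  TwoSidedIdeal.span
    {g | ∃ f ∈ S, ∃ φ : FreeAlgebra K ℕ →ₐ[K] FreeAlgebra K ℕ, g = φ f}

lemma adIter_succ_out {A : Type*} [Ring A] (x : A) (m : ℕ) (z : A) :
    adIter x (m + 1) z = adIter x m z * x - x * adIter x m z := by
  simp only [adIter, Function.iterate_succ_apply']

lemma adIter_succ_in {A : Type*} [Ring A] (x : A) (m : ℕ) (z : A) :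
    adIter x (m + 1) z = adIter x m (z * x - x * z) := by
  simp only [adIter, Function.iterate_succ_apply]

lemma adIter_mul_right {A : Type*} [Ring A] (x : A) (m : ℕ) (z : A) :
    adIter x m (z * x) = adIter x m z * x := by
  induction m with
  | zero => rfl
  | succ k ih => rw [adIter_succ_out, adIter_succ_out, ih]; noncomm_ring

lemma map_adIter {A B F : Type*} [Ring A] [Ring B] [FunLike F A B] [RingHomClass F A B]
    (φ : F) (x : A) (m : ℕ) (z : A) :
    φ (adIter x m z) = adIter (φ x) m (φ z) := by
  induction m with
  | zero => rfl
  | succ k ih => rw [adIter_succ_out, adIter_succ_out, map_sub, map_mul, map_mul, ih]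

lemma gen_mem (K : Type*) [Field K] (m : ℕ) (S : Set (FreeAlgebra K ℕ))
    (hS : br (tv K 0) (tv K 1) * adIter (tv K 0) m (tv K 2)
          - br (tv K 0) (tv K 2) * adIter (tv K 0) m (tv K 1) ∈ S) (y z : FreeAlgebra K ℕ) :
    br (tv K 0) y * adIter (tv K 0) m z - br (tv K 0) z * adIter (tv K 0) m y
      ∈ TIdealGen K S := by
  apply TwoSidedIdeal.subset_span
  let g : ℕ → FreeAlgebra K ℕ := fun i => if i = 0 then tv K 0 else if i = 1 then y else z
  refine ⟨_, hS, FreeAlgebra.lift K g, ?_⟩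
  have h0 : FreeAlgebra.lift K g (tv K 0) = tv K 0 := by simp [tv, g]
  have h1 : FreeAlgebra.lift K g (tv K 1) = y := by simp [tv, g]
  have h2 : FreeAlgebra.lift K g (tv K 2) = z := by simp [tv, g]
  simp only [br, map_sub, map_mul, map_adIter, h0, h1, h2]

lemma key_mem (K : Type*) [Field K] (m : ℕ) (S : Set (FreeAlgebra K ℕ))
    (hS : br (tv K 0) (tv K 1) * adIter (tv K 0) m (tv K 2)
          - br (tv K 0) (tv K 2) * adIter (tv K 0) m (tv K 1) ∈ S) (y z : FreeAlgebra K ℕ) :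
    br (tv K 0) z * adIter (tv K 0) (m + 1) y ∈ TIdealGen K S := by
  have h1 := gen_mem K m S hS y (z * tv K 0)
  have h2 := TwoSidedIdeal.mul_mem_right _ _ (tv K 0) (gen_mem K m S hS y z)
  have h3 := TwoSidedIdeal.sub_mem _ h1 h2
  convert h3 using 1
  rw [adIter_mul_right, adIter_succ_out]
  simp only [br]
  noncomm_ring

/- STATEMENT 11: for n ≥ 4, the polynomials [t1,t2][t1,t2,t1^(n-3)] and
[t1,t2][t3,t1^(n-2)] - [t1,t3][t2,t1^(n-2)] belong to the T-ideal generated by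
[t1,t2][t3,t1^(n-3)] - [t1,t3][t2,t1^(n-3)] together with [[t1,t2][t3,t4],t5],
[t1,t2][t3,t4][t5,t6] and s4. -/
theorem stmt11 (K : Type*) [Field K] [CharZero K] (n : ℕ) (hn : 4 ≤ n) :
    br (tv K 0) (tv K 1) * adIter (tv K 0) (n - 3) (br (tv K 0) (tv K 1)) ∈
      TIdealGen K {br (tv K 0) (tv K 1) * adIter (tv K 0) (n - 3) (tv K 2)
          - br (tv K 0) (tv K 2) * adIter (tv K 0) (n - 3) (tv K 1),
        p₁ K, p₂ K, s4poly K}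
    ∧ br (tv K 0) (tv K 1) * adIter (tv K 0) (n - 2) (tv K 2)
        - br (tv K 0) (tv K 2) * adIter (tv K 0) (n - 2) (tv K 1) ∈
      TIdealGen K {br (tv K 0) (tv K 1) * adIter (tv K 0) (n - 3) (tv K 2)
          - br (tv K 0) (tv K 2) * adIter (tv K 0) (n - 3) (tv K 1),
        p₁ K, p₂ K, s4poly K} := by
  obtain ⟨m, rfl⟩ : ∃ m, n = m + 3 := ⟨n - 3, by omega⟩
  have e1 : m + 3 - 3 = m := by omega
  have e2 : m + 3 - 2 = m + 1 := by omega
  rw [e1, e2]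
  refine ⟨?_, TwoSidedIdeal.sub_mem _ ?_ ?_⟩
  · have h := key_mem K m _ (Set.mem_insert _ {p₁ K, p₂ K, s4poly K}) (-(tv K 1)) (tv K 1)
    rw [adIter_succ_in] at h
    convert h using 3
    simp only [br]
    noncomm_ring
  · exact key_mem K m _ (Set.mem_insert _ _) _ _
  · exact key_mem K m _ (Set.mem_insert _ _) _ _
end
end

section
/- For every integer n >= 4, the polynomial [t1,t2,t1^(n-1)] belongs neither to the T-ideal generated by [t1,t2][t1,t2,t1^(n-4)] together with the three polynomials [[t1,t2][t3,t4],t5], [t1,t2][t3,t4][t5,t6], s4(t1,t2,t3,t4), nor to the T-ideal generated by [t1,t2][t3,t1^(n-3)] - [t1,t3][t2,t1^(n-3)] together with the same three polynomials. -/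
noncomputable section

/-- The representation in upper triangular 2x2 matrices. -/
def psiUT (K : Type*) [Field K] : FreeAlgebra K ℕ →ₐ[K] Matrix (Fin 2) (Fin 2) K :=
  FreeAlgebra.lift K (fun i => if i = 0 then !![1, 0; 0, 0] else !![0, 1; 0, 0])

theorem psiUT_low (K : Type*) [Field K] (f : FreeAlgebra K ℕ) : psiUT K f 1 0 = 0 := by
  induction f using FreeAlgebra.induction with
  | grade0 r => simp [Matrix.algebraMap_matrix_apply]
  | grade1 i =>
    simp only [psiUT, FreeAlgebra.lift_ι_apply]
    split_ifs <;> simp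
  | mul a b ha hb => simp [Matrix.mul_apply, ha, hb]
  | add a b ha hb => simp [ha, hb]

theorem psiUT_br (K : Type*) [Field K] (a b c d : FreeAlgebra K ℕ) :
    psiUT K (br a b * br c d) = 0 := by
  have ha := psiUT_low K a
  have hb := psiUT_low K b
  have hc := psiUT_low K c
  have hd := psiUT_low K d
  simp only [br, map_mul, map_sub]
  ext i j
  fin_cases i <;> fin_cases j <;>
    simp [Matrix.mul_apply, Fin.sum_univ_two, ha, hb, hc, hd] <;> ring_nf <;> simp

theorem adIter_br (K : Type*) [Field K] (x a b : FreeAlgebra K ℕ) (l : ℕ) :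
    ∃ c d, adIter x l (br a b) = br c d := by
  cases l with
  | zero => exact ⟨a, b, rfl⟩
  | succ l => exact ⟨adIter x l (br a b), x, by simp [adIter, br, Function.iterate_succ_apply']⟩

theorem map_br {K : Type*} [Field K] (φ : FreeAlgebra K ℕ →ₐ[K] FreeAlgebra K ℕ)
    (a b : FreeAlgebra K ℕ) : φ (br a b) = br (φ a) (φ b) := by
  simp [br]

theorem psiUT_s4 (K : Type*) [Field K] [CharZero K] (x : Fin 4 → FreeAlgebra K ℕ) :
    psiUT K (∑ σ : Equiv.Perm (Fin 4), (Equiv.Perm.sign σ : ℤ) •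
      (x (σ 0) * x (σ 1) * x (σ 2) * x (σ 3))) = 0 := by
  have h1 : (∑ σ : Equiv.Perm (Fin 4), (Equiv.Perm.sign σ : ℤ) •
      (x (σ 0) * x (σ 1) * x (σ 2) * x (σ 3))) = - ∑ σ : Equiv.Perm (Fin 4),
      (Equiv.Perm.sign σ : ℤ) • (x (σ 1) * x (σ 0) * x (σ 2) * x (σ 3)) := by
    rw [← Finset.sum_neg_distrib]
    refine Fintype.sum_equiv (Equiv.mulRight (Equiv.swap 0 1)) _ _ fun σ => ?_
    have e2 : (Equiv.swap (0 : Fin 4) 1) 2 = 2 := by decide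
    have e3 : (Equiv.swap (0 : Fin 4) 1) 3 = 3 := by decide
    simp [e2, e3]
  have h2 : (∑ σ : Equiv.Perm (Fin 4), (Equiv.Perm.sign σ : ℤ) •
      (br (x (σ 0)) (x (σ 1)) * x (σ 2) * x (σ 3))) = - ∑ σ : Equiv.Perm (Fin 4),
      (Equiv.Perm.sign σ : ℤ) • (br (x (σ 0)) (x (σ 1)) * x (σ 3) * x (σ 2)) := by
    rw [← Finset.sum_neg_distrib]
    refine Fintype.sum_equiv (Equiv.mulRight (Equiv.swap 2 3)) _ _ fun σ => ?_
    have e2 : (Equiv.swap (2 : Fin 4) 3) 0 = 0 := by decide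
    have e3 : (Equiv.swap (2 : Fin 4) 3) 1 = 1 := by decide
    simp [e2, e3]
  have h3 : (∑ σ : Equiv.Perm (Fin 4), (Equiv.Perm.sign σ : ℤ) •
      (br (x (σ 0)) (x (σ 1)) * x (σ 2) * x (σ 3))) =
      (2 : K) • (∑ σ : Equiv.Perm (Fin 4), (Equiv.Perm.sign σ : ℤ) •
      (x (σ 0) * x (σ 1) * x (σ 2) * x (σ 3))) := by
    rw [two_smul]
    nth_rewrite 2 [h1]
    rw [← sub_eq_add_neg, ← Finset.sum_sub_distrib]
    refine Finset.sum_congr rfl fun σ _ => ?_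
    rw [← smul_sub, br, sub_mul, sub_mul]
  have h4 : (∑ σ : Equiv.Perm (Fin 4), (Equiv.Perm.sign σ : ℤ) •
      (br (x (σ 0)) (x (σ 1)) * br (x (σ 2)) (x (σ 3)))) =
      (2 : K) • ∑ σ : Equiv.Perm (Fin 4), (Equiv.Perm.sign σ : ℤ) •
      (br (x (σ 0)) (x (σ 1)) * x (σ 2) * x (σ 3)) := by
    rw [two_smul]
    nth_rewrite 2 [h2]
    rw [← sub_eq_add_neg, ← Finset.sum_sub_distrib]
    refine Finset.sum_congr rfl fun σ _ => ?_
    rw [← smul_sub, br, br, mul_sub, mul_assoc, mul_assoc]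
  have h5 : psiUT K (∑ σ : Equiv.Perm (Fin 4), (Equiv.Perm.sign σ : ℤ) •
      (br (x (σ 0)) (x (σ 1)) * br (x (σ 2)) (x (σ 3)))) = 0 := by
    rw [map_sum]
    refine Finset.sum_eq_zero fun σ _ => ?_
    rw [map_zsmul, psiUT_br, smul_zero]
  rw [h4, h3, map_smul, map_smul] at h5
  simpa using h5

theorem not_mem_aux (K : Type*) [Field K] [CharZero K] (m : ℕ) (f : FreeAlgebra K ℕ)
    (hf : ∀ φ : FreeAlgebra K ℕ →ₐ[K] FreeAlgebra K ℕ, psiUT K (φ f) = 0) :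
    adIter (tv K 0) m (br (tv K 0) (tv K 1)) ∉ TIdealGen K {f, p₁ K, p₂ K, s4poly K} := by
  intro hmem
  have hle : TIdealGen K {f, p₁ K, p₂ K, s4poly K} ≤ TwoSidedIdeal.ker (psiUT K) := by
    refine TwoSidedIdeal.span_le.2 ?_
    rintro g ⟨f', hf', φ, rfl⟩
    simp only [SetLike.mem_coe, TwoSidedIdeal.mem_ker]
    simp only [Set.mem_insert_iff, Set.mem_singleton_iff] at hf'
    rcases hf' with rfl | rfl | rfl | rfl
    · exact hf φ
    · rw [p₁, map_br, map_mul, map_br, map_br]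
      rw [br, map_sub, map_mul, map_mul _ (φ (tv K 4)), psiUT_br]
      simp
    · rw [p₂, map_mul, map_mul, map_mul φ, map_br, map_br, psiUT_br, zero_mul]
    · have := psiUT_s4 K (fun i => φ (tv K i))
      rw [← this, s4poly, map_sum]
      congr 1
      refine Finset.sum_congr rfl fun σ _ => ?_
      rw [map_zsmul, map_mul, map_mul, map_mul]
  have h := hle hmem
  rw [TwoSidedIdeal.mem_ker] at h
  have key : ∀ l : ℕ, psiUT K (adIter (tv K 0) l (br (tv K 0) (tv K 1))) =
      !![0, (-1) ^ l; 0, 0] := by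
    intro l
    induction l with
    | zero =>
      ext i j
      fin_cases i <;> fin_cases j <;> simp [adIter, br, tv, psiUT]
    | succ l ih =>
      have : adIter (tv K 0) (l + 1) (br (tv K 0) (tv K 1)) =
        adIter (tv K 0) l (br (tv K 0) (tv K 1)) * tv K 0
          - tv K 0 * adIter (tv K 0) l (br (tv K 0) (tv K 1)) := by
        simp only [adIter, Function.iterate_succ_apply']
      rw [this, map_sub, map_mul, map_mul, ih]
      ext i j
      fin_cases i <;> fin_cases j <;> simp [tv, psiUT, pow_succ]
  rw [key] at h
  have := congrFun (congrFun h 0) 1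
  simp at this

theorem map_adIter_s12 {K : Type*} [Field K] (φ : FreeAlgebra K ℕ →ₐ[K] FreeAlgebra K ℕ)
    (c z : FreeAlgebra K ℕ) (l : ℕ) : φ (adIter c l z) = adIter (φ c) l (φ z) := by
  induction l with
  | zero => rfl
  | succ l ih =>
    simp only [adIter, Function.iterate_succ_apply'] at ih ⊢
    rw [map_sub, map_mul, map_mul, ih]

theorem adIter_succ_br (K : Type*) [Field K] (x a : FreeAlgebra K ℕ) (l : ℕ) :
    ∃ c d, adIter x (l + 1) a = br c d :=
  ⟨adIter x l a, x, by simp only [adIter, br, Function.iterate_succ_apply']⟩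

/- STATEMENT 12: for n ≥ 4, the polynomial [t1,t2,t1^(n-1)] belongs neither to the T-ideal
generated by [t1,t2][t1,t2,t1^(n-4)] together with [[t1,t2][t3,t4],t5],
[t1,t2][t3,t4][t5,t6], s4, nor to the T-ideal generated by
[t1,t2][t3,t1^(n-3)] - [t1,t3][t2,t1^(n-3)] together with the same three polynomials. -/
theorem stmt12 (K : Type*) [Field K] [CharZero K] (n : ℕ) (hn : 4 ≤ n) :
    adIter (tv K 0) (n - 1) (br (tv K 0) (tv K 1)) ∉
      TIdealGen K {br (tv K 0) (tv K 1) * adIter (tv K 0) (n - 4) (br (tv K 0) (tv K 1)),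
        p₁ K, p₂ K, s4poly K}
    ∧ adIter (tv K 0) (n - 1) (br (tv K 0) (tv K 1)) ∉
      TIdealGen K {br (tv K 0) (tv K 1) * adIter (tv K 0) (n - 3) (tv K 2)
          - br (tv K 0) (tv K 2) * adIter (tv K 0) (n - 3) (tv K 1),
        p₁ K, p₂ K, s4poly K} := by
  refine ⟨not_mem_aux K _ _ fun φ => ?_, not_mem_aux K _ _ fun φ => ?_⟩
  · rw [map_mul, map_br, map_adIter_s12, map_br]
    obtain ⟨c, d, h⟩ := adIter_br K (φ (tv K 0)) (φ (tv K 0)) (φ (tv K 1)) (n - 4)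
    rw [h, psiUT_br]
  · obtain ⟨m, rfl⟩ := Nat.exists_eq_add_of_le hn
    have hm : 4 + m - 3 = m + 1 := by omega
    rw [hm, map_sub, map_mul, map_mul, map_br, map_br, map_adIter_s12, map_adIter_s12]
    obtain ⟨c, d, h⟩ := adIter_succ_br K (φ (tv K 0)) (φ (tv K 2)) m
    obtain ⟨c', d', h'⟩ := adIter_succ_br K (φ (tv K 0)) (φ (tv K 1)) m
    rw [h, h', map_sub, psiUT_br, psiUT_br, sub_zero]
end
end
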